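/- (Appendix B conditional-leakage bounds) Let S1, S2, Y, Ū be finite-valued random variables on a probability space, write S=(S1,S2), let 0 ≤ α2 ≤ 1, let B be a Bernoulli(α2) random variable independent of (S1,S2,Y,Ū), let c be a point not in the alphabet of S2, define W = S2 if B = 1 and W = c if B = 0, and set U = (Ū, W). Then both of the following hold: (i) I(U; S | Y) ≤ I(Ū; S | Y) + α2 · H(S2|Y); and (ii) I(U; S | Y) ≤ (1−α2) · I(Ū; S | Y) + α2 · H(S1,S2|Y). -/

import Mathlib

open MeasureTheory ProbabilityTheory Real

noncomputable section

/-- The probability mass function of a random variable `X` under the measure `μ`. -/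
def pm {Ω : Type*} [MeasurableSpace Ω] (μ : Measure Ω) {𝒳 : Type*} (X : Ω → 𝒳) (x : 𝒳) : ℝ :=
  (μ (X ⁻¹' {x})).toReal

/-- Shannon entropy (base 2) of a finite-valued random variable. -/
def ent {Ω : Type*} [MeasurableSpace Ω] (μ : Measure Ω) {𝒳 : Type*} [Fintype 𝒳]
    (X : Ω → 𝒳) : ℝ :=
  -∑ x, pm μ X x * Real.logb 2 (pm μ X x)

/-- Conditional entropy `H(X|Y) = H(X,Y) - H(Y)` (base 2). -/
def condEnt {Ω : Type*} [MeasurableSpace Ω] (μ : Measure Ω) {𝒳 𝒴 : Type*} [Fintype 𝒳]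
    [Fintype 𝒴] (X : Ω → 𝒳) (Y : Ω → 𝒴) : ℝ :=
  ent μ (fun ω => (X ω, Y ω)) - ent μ Y

/-- Mutual information `I(X;Y) = H(X) + H(Y) - H(X,Y)` (base 2). -/
def mi {Ω : Type*} [MeasurableSpace Ω] (μ : Measure Ω) {𝒳 𝒴 : Type*} [Fintype 𝒳]
    [Fintype 𝒴] (X : Ω → 𝒳) (Y : Ω → 𝒴) : ℝ :=
  ent μ X + ent μ Y - ent μ (fun ω => (X ω, Y ω))

/-- Conditional mutual information `I(X;Y|Z) = H(X|Z) + H(Y|Z) - H((X,Y)|Z)` (base 2). -/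
def condMI {Ω : Type*} [MeasurableSpace Ω] (μ : Measure Ω) {𝒳 𝒴 𝒵 : Type*} [Fintype 𝒳]
    [Fintype 𝒴] [Fintype 𝒵] (X : Ω → 𝒳) (Y : Ω → 𝒴) (Z : Ω → 𝒵) : ℝ :=
  condEnt μ X Z + condEnt μ Y Z - condEnt μ (fun ω => (X ω, Y ω)) Z

section Entropy

variable {Ω : Type*} [MeasurableSpace Ω] {μ : Measure Ω}

lemma pm_nonneg {𝒳 : Type*} (X : Ω → 𝒳) (x : 𝒳) : 0 ≤ pm μ X x :=
  ENNReal.toReal_nonneg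

lemma pm_le_pm_comp [IsProbabilityMeasure μ] {𝒯 𝒳 : Type*} (T : Ω → 𝒯) (f : 𝒯 → 𝒳) (t : 𝒯) :
    pm μ T t ≤ pm μ (fun ω => f (T ω)) (f t) := by
  refine ENNReal.toReal_mono (measure_ne_top _ _) (measure_mono ?_)
  rintro ω rfl
  rfl

lemma pm_comp_of_injective {𝒯 𝒳 : Type*} (T : Ω → 𝒯) {f : 𝒯 → 𝒳} (hf : Function.Injective f)
    (t : 𝒯) : pm μ (fun ω => f (T ω)) (f t) = pm μ T t := by
  unfold pm
  congr 2
  ext ω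
  simp [hf.eq_iff]

/-- Law of the unconscious statistician: the law of `f ∘ T` integrates `φ` as the law of `T`
integrates `φ ∘ f`. -/
lemma sum_pm_comp_mul [IsProbabilityMeasure μ] {𝒯 𝒳 : Type*} [Fintype 𝒯] [MeasurableSpace 𝒯]
    [MeasurableSingletonClass 𝒯] [Fintype 𝒳] {T : Ω → 𝒯} (hT : Measurable T) (f : 𝒯 → 𝒳)
    (φ : 𝒳 → ℝ) :
    ∑ x, pm μ (fun ω => f (T ω)) x * φ x = ∑ t, pm μ T t * φ (f t) := by
  classical
  have key : ∀ x, pm μ (fun ω => f (T ω)) x = ∑ t with f t = x, pm μ T t := by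
    intro x
    have h := sum_measureReal_preimage_singleton (μ := μ) (Finset.univ.filter fun t => f t = x)
      (f := T) fun t _ => hT (measurableSet_singleton t)
    refine Eq.trans ?_ h.symm
    unfold pm Measure.real
    congr 2
    ext ω
    simp
  rw [← Finset.sum_fiberwise (s := Finset.univ) (g := f)]
  refine Finset.sum_congr rfl fun x _ => ?_
  rw [key, Finset.sum_mul]
  refine Finset.sum_congr rfl fun t ht => ?_
  rw [(Finset.mem_filter.mp ht).2]

lemma sum_pm [IsProbabilityMeasure μ] {𝒯 : Type*} [Fintype 𝒯] [MeasurableSpace 𝒯]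
    [MeasurableSingletonClass 𝒯] {T : Ω → 𝒯} (hT : Measurable T) : ∑ t, pm μ T t = 1 := by
  have h := sum_pm_comp_mul (μ := μ) hT (fun _ => ()) (fun _ => 1)
  simpa [pm] using h.symm

lemma ent_comp [IsProbabilityMeasure μ] {𝒯 𝒳 : Type*} [Fintype 𝒯] [MeasurableSpace 𝒯]
    [MeasurableSingletonClass 𝒯] [Fintype 𝒳] {T : Ω → 𝒯} (hT : Measurable T) (f : 𝒯 → 𝒳) :
    ent μ (fun ω => f (T ω)) =
      -∑ t, pm μ T t * Real.logb 2 (pm μ (fun ω => f (T ω)) (f t)) := by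
  unfold ent
  rw [sum_pm_comp_mul hT f fun x => Real.logb 2 (pm μ (fun ω => f (T ω)) x)]

lemma ent_comp_of_injective [IsProbabilityMeasure μ] {𝒯 𝒳 : Type*} [Fintype 𝒯]
    [MeasurableSpace 𝒯] [MeasurableSingletonClass 𝒯] [Fintype 𝒳] {T : Ω → 𝒯}
    (hT : Measurable T) {f : 𝒯 → 𝒳} (hf : Function.Injective f) :
    ent μ (fun ω => f (T ω)) = ent μ T := by
  rw [ent_comp hT]
  simp only [pm_comp_of_injective T hf, ent]

lemma ent_comp_le [IsProbabilityMeasure μ] {𝒯 𝒳 : Type*} [Fintype 𝒯] [MeasurableSpace 𝒯]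
    [MeasurableSingletonClass 𝒯] [Fintype 𝒳] {T : Ω → 𝒯} (hT : Measurable T) (f : 𝒯 → 𝒳) :
    ent μ (fun ω => f (T ω)) ≤ ent μ T := by
  rw [ent_comp hT]
  refine neg_le_neg (Finset.sum_le_sum fun t _ => ?_)
  rcases (pm_nonneg (μ := μ) T t).eq_or_lt with h | h
  · simp [← h]
  · exact mul_le_mul_of_nonneg_left
      (Real.logb_le_logb_of_le one_lt_two h (pm_le_pm_comp T f t)) h.le

/-- Strong subadditivity of the Shannon entropy. -/
lemma ent_submodular [IsProbabilityMeasure μ] {𝒳 𝒴 𝒵 : Type*}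
    [Fintype 𝒳] [MeasurableSpace 𝒳] [MeasurableSingletonClass 𝒳]
    [Fintype 𝒴] [MeasurableSpace 𝒴] [MeasurableSingletonClass 𝒴]
    [Fintype 𝒵] [MeasurableSpace 𝒵] [MeasurableSingletonClass 𝒵]
    {X : Ω → 𝒳} {Y : Ω → 𝒴} {Z : Ω → 𝒵}
    (hX : Measurable X) (hY : Measurable Y) (hZ : Measurable Z) :
    ent μ (fun ω => (X ω, Y ω, Z ω)) + ent μ Z
      ≤ ent μ (fun ω => (X ω, Z ω)) + ent μ (fun ω => (Y ω, Z ω)) := by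
  have hT : Measurable fun ω => (X ω, Y ω, Z ω) := hX.prodMk (hY.prodMk hZ)
  have eXZ := ent_comp (μ := μ) hT fun t => (t.1, t.2.2)
  have eYZ := ent_comp (μ := μ) hT fun t => t.2
  have eZ := ent_comp (μ := μ) hT fun t => t.2.2
  have lXZ := pm_le_pm_comp (μ := μ) (fun ω => (X ω, Y ω, Z ω)) fun t => (t.1, t.2.2)
  have lYZ := pm_le_pm_comp (μ := μ) (fun ω => (X ω, Y ω, Z ω)) fun t => t.2
  have lZ := pm_le_pm_comp (μ := μ) (fun ω => (X ω, Y ω, Z ω)) fun t => t.2.2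
  have mX : ∀ z, ∑ x, pm μ (fun ω => (X ω, Z ω)) (x, z) = pm μ Z z := by
    classical
    intro z
    have h := sum_pm_comp_mul (μ := μ) (hX.prodMk hZ) Prod.snd fun z' => if z' = z then 1 else 0
    simpa [Fintype.sum_prod_type] using h.symm
  have mY : ∀ z, ∑ y, pm μ (fun ω => (Y ω, Z ω)) (y, z) = pm μ Z z := by
    classical
    intro z
    have h := sum_pm_comp_mul (μ := μ) (hY.prodMk hZ) Prod.snd fun z' => if z' = z then 1 else 0
    simpa [Fintype.sum_prod_type] using h.symm
  have hq : ∑ t : 𝒳 × 𝒴 × 𝒵, pm μ (fun ω => (X ω, Z ω)) (t.1, t.2.2) *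
      pm μ (fun ω => (Y ω, Z ω)) t.2 / pm μ Z t.2.2 = 1 := by
    rw [← sum_pm (μ := μ) hZ]
    simp only [Fintype.sum_prod_type]
    simp_rw [Finset.sum_comm (s := (Finset.univ : Finset 𝒴))]
    rw [Finset.sum_comm]
    refine Finset.sum_congr rfl fun z _ => ?_
    simp_rw [← Finset.sum_div, ← Finset.mul_sum, ← Finset.sum_mul, mX, mY]
    exact mul_self_div_self _
  simp only at eXZ eYZ eZ lXZ lYZ lZ
  rw [eXZ, eYZ, eZ]
  have hlog : 0 < Real.log 2 := Real.log_pos one_lt_two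
  have key : ∀ t : 𝒳 × 𝒴 × 𝒵, pm μ (fun ω => (X ω, Y ω, Z ω)) t *
      (Real.logb 2 (pm μ (fun ω => (X ω, Z ω)) (t.1, t.2.2))
        + Real.logb 2 (pm μ (fun ω => (Y ω, Z ω)) t.2)
        - Real.logb 2 (pm μ (fun ω => (X ω, Y ω, Z ω)) t) - Real.logb 2 (pm μ Z t.2.2))
      ≤ (pm μ (fun ω => (X ω, Z ω)) (t.1, t.2.2) * pm μ (fun ω => (Y ω, Z ω)) t.2 / pm μ Z t.2.2
          - pm μ (fun ω => (X ω, Y ω, Z ω)) t) / Real.log 2 := by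
    intro t
    have h₁ := lXZ t
    have h₂ := lYZ t
    have h₃ := lZ t
    have h₄ := pm_nonneg (μ := μ) (fun ω => (X ω, Y ω, Z ω)) t
    generalize pm μ (fun ω => (X ω, Y ω, Z ω)) t = p at *
    generalize pm μ (fun ω => (X ω, Z ω)) (t.1, t.2.2) = a at *
    generalize pm μ (fun ω => (Y ω, Z ω)) t.2 = b at *
    generalize pm μ Z t.2.2 = d at *
    rcases h₄.eq_or_lt with rfl | hp
    · simp only [zero_mul, sub_zero]
      positivity
    have ha := hp.trans_le h₁
    have hb := hp.trans_le h₂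
    have hd := hp.trans_le h₃
    have hle := Real.log_le_sub_one_of_pos (show 0 < a * b / d / p by positivity)
    rw [Real.log_div (by positivity) hp.ne', Real.log_div (by positivity) hd.ne',
      Real.log_mul ha.ne' hb.ne'] at hle
    have hmul := mul_le_mul_of_nonneg_left hle hp.le
    rw [mul_sub_one, mul_div_cancel₀ _ hp.ne'] at hmul
    refine le_of_eq_of_le ?_ (div_le_div_of_nonneg_right hmul hlog.le)
    simp only [Real.logb]
    ring
  have hsum := Finset.sum_le_sum fun t (_ : t ∈ Finset.univ) => key t
  rw [← Finset.sum_div, Finset.sum_sub_distrib, hq, sum_pm hT, sub_self, zero_div] at hsum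
  simp only [mul_sub, mul_add, Finset.sum_sub_distrib, Finset.sum_add_distrib] at hsum
  rw [ent]
  linarith

/-- Entropy of a pair whose second component is erased by an independent coin. -/
lemma ent_prodMk_ite [IsProbabilityMeasure μ] {𝒳 𝒵 𝒲 : Type*}
    [Fintype 𝒳] [MeasurableSpace 𝒳] [MeasurableSingletonClass 𝒳]
    [Fintype 𝒵] [MeasurableSpace 𝒵] [MeasurableSingletonClass 𝒵] [Fintype 𝒲]
    {B : Ω → Bool} {X : Ω → 𝒳} {Z : Ω → 𝒵}
    (hB : Measurable B) (hX : Measurable X) (hZ : Measurable Z)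
    (hind : IndepFun B (fun ω => (Z ω, X ω)) μ)
    {ι : 𝒳 → 𝒲} (hι : Function.Injective ι) {c : 𝒲} (hc : c ∉ Set.range ι) :
    ent μ (fun ω => (Z ω, if B ω then ι (X ω) else c)) =
      ent μ B + pm μ B true * ent μ (fun ω => (Z ω, X ω)) + (1 - pm μ B true) * ent μ Z := by
  have hmul : ∀ a b : ℝ, a * b * Real.logb 2 (a * b) =
      a * Real.logb 2 a * b + a * (b * Real.logb 2 b) := by
    intro a b
    rcases eq_or_ne a 0 with rfl | ha
    · simp
    rcases eq_or_ne b 0 with rfl | hb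
    · simp
    rw [Real.logb_mul ha hb]
    ring
  have hfalse : pm μ B false = 1 - pm μ B true := by
    have h := sum_pm (μ := μ) hB
    rw [Fintype.sum_bool] at h
    linarith
  set V : Ω → 𝒵 × Option 𝒳 := fun ω => (Z ω, if B ω then some (X ω) else none) with hV
  have pm_some : ∀ z x, pm μ V (z, some x) =
      pm μ B true * pm μ (fun ω => (Z ω, X ω)) (z, x) := by
    intro z x
    have h := hind.measure_inter_preimage_eq_mul {true} {(z, x)} (measurableSet_singleton _)
      (measurableSet_singleton _)
    unfold pm
    rw [← ENNReal.toReal_mul, ← h]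
    congr 2
    ext ω
    cases hb : B ω <;> simp [hV, hb]
  have pm_none : ∀ z, pm μ V (z, none) = pm μ B false * pm μ Z z := by
    intro z
    have h := (hind.comp measurable_id measurable_fst).measure_inter_preimage_eq_mul {false} {z}
      (measurableSet_singleton _) (measurableSet_singleton _)
    simp only [Function.comp_def, id] at h
    unfold pm
    rw [← ENNReal.toReal_mul, ← h]
    congr 2
    ext ω
    cases hb : B ω <;> simp [hV, hb]
  have hVent : ent μ (fun ω => (Z ω, if B ω then ι (X ω) else c)) = ent μ V := by
    let _ : MeasurableSpace (Option 𝒳) := ⊤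
    have : MeasurableSingletonClass (Option 𝒳) := ⟨fun _ => trivial⟩
    have hVm : Measurable V := hZ.prodMk
      (((Measurable.of_discrete (f := some)).comp hX).ite (hB (measurableSet_singleton true))
        measurable_const)
    have hinj : Function.Injective fun v : 𝒵 × Option 𝒳 => (v.1, v.2.elim c ι) := by
      rintro ⟨z, _ | x⟩ ⟨z', _ | x'⟩ h
      · simpa using h
      · exact absurd ⟨x', (Prod.ext_iff.mp h).2.symm⟩ hc
      · exact absurd ⟨x, (Prod.ext_iff.mp h).2⟩ hc
      · simpa [hι.eq_iff] using h
    rw [← ent_comp_of_injective hVm hinj]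
    congr 1
    funext ω
    cases hb : B ω <;> simp [hV, hb]
  have hZX := sum_pm (μ := μ) (hZ.prodMk hX)
  have hZ1 := sum_pm (μ := μ) hZ
  rw [hVent, ← hfalse]
  unfold ent
  rw [Fintype.sum_prod_type] at hZX
  simp only [Fintype.sum_prod_type, Fintype.sum_option, Fintype.sum_bool, pm_some, pm_none, hmul,
    Finset.sum_add_distrib, ← Finset.mul_sum, hZX, hZ1]
  ring

end Entropy

/-- Appendix B conditional-leakage bounds. With `S = (S1,S2)`, `B`
Bernoulli(`α2`) independent of `(S1,S2,Y,Ū)`, `W` the `α2`-randomized response revealing `S2`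
(dummy symbol `c` otherwise) and `U = (Ū,W)`:
(i) `I(U;S|Y) ≤ I(Ū;S|Y) + α2·H(S2|Y)`, and
(ii) `I(U;S|Y) ≤ (1−α2)·I(Ū;S|Y) + α2·H(S1,S2|Y)`. -/
theorem randomized_response_conditional_leakage
    {Ω : Type*} [MeasurableSpace Ω] (μ : Measure Ω) [IsProbabilityMeasure μ]
    {𝒮₁ 𝒮₂ 𝒴 𝒰 𝒲 : Type*}
    [Fintype 𝒮₁] [Nonempty 𝒮₁] [MeasurableSpace 𝒮₁] [MeasurableSingletonClass 𝒮₁]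
    [Fintype 𝒮₂] [Nonempty 𝒮₂] [MeasurableSpace 𝒮₂] [MeasurableSingletonClass 𝒮₂]
    [Fintype 𝒴] [Nonempty 𝒴] [MeasurableSpace 𝒴] [MeasurableSingletonClass 𝒴]
    [Fintype 𝒰] [Nonempty 𝒰] [MeasurableSpace 𝒰] [MeasurableSingletonClass 𝒰]
    [Fintype 𝒲] [Nonempty 𝒲] [MeasurableSpace 𝒲] [MeasurableSingletonClass 𝒲]
    (S₁ : Ω → 𝒮₁) (S₂ : Ω → 𝒮₂) (Y : Ω → 𝒴) (Ubar : Ω → 𝒰)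
    (hS₁ : Measurable S₁) (hS₂ : Measurable S₂) (hY : Measurable Y)
    (hUbar : Measurable Ubar)
    (α₂ : ℝ) (hα0 : 0 ≤ α₂) (hα1 : α₂ ≤ 1)
    (B : Ω → Bool) (hB : Measurable B)
    (hBer : pm μ B true = α₂)
    (hBindep : IndepFun B (fun ω => (S₁ ω, S₂ ω, Y ω, Ubar ω)) μ)
    (ι : 𝒮₂ → 𝒲) (hι : Function.Injective ι) (hιmeas : Measurable ι)
    (c : 𝒲) (hc : c ∉ Set.range ι)
    (W : Ω → 𝒲) (hW : W = fun ω => if B ω then ι (S₂ ω) else c)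
    (U : Ω → 𝒰 × 𝒲) (hU : U = fun ω => (Ubar ω, W ω)) :
    condMI μ U (fun ω => (S₁ ω, S₂ ω)) Y
        ≤ condMI μ Ubar (fun ω => (S₁ ω, S₂ ω)) Y + α₂ * condEnt μ S₂ Y ∧
    condMI μ U (fun ω => (S₁ ω, S₂ ω)) Y
        ≤ (1 - α₂) * condMI μ Ubar (fun ω => (S₁ ω, S₂ ω)) Y
          + α₂ * condEnt μ (fun ω => (S₁ ω, S₂ ω)) Y := by
  subst hW hU
  have hUY := ent_prodMk_ite hB hS₂ (hUbar.prodMk hY)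
    (hBindep.comp measurable_id
      (Measurable.of_discrete (f := fun t : 𝒮₁ × 𝒮₂ × 𝒴 × 𝒰 => ((t.2.2.2, t.2.2.1), t.2.1))))
    hι hc
  have hUSY := ent_prodMk_ite hB hS₂ ((hUbar.prodMk (hS₁.prodMk hS₂)).prodMk hY)
    (hBindep.comp measurable_id
      (Measurable.of_discrete (f := fun t : 𝒮₁ × 𝒮₂ × 𝒴 × 𝒰 =>
        (((t.2.2.2, (t.1, t.2.1)), t.2.2.1), t.2.1))))
    hι hc
  have hWm : Measurable fun ω => if B ω then ι (S₂ ω) else c :=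
    (hιmeas.comp hS₂).ite (hB (measurableSet_singleton true)) measurable_const
  have rUY := ent_comp_of_injective (μ := μ) ((hUbar.prodMk hY).prodMk hWm)
    (f := fun t => ((t.1.1, t.2), t.1.2)) (fun _ _ h => by simp_all [Prod.ext_iff])
  have rUSY := ent_comp_of_injective (μ := μ)
    (((hUbar.prodMk (hS₁.prodMk hS₂)).prodMk hY).prodMk hWm)
    (f := fun t => (((t.1.1.1, t.2), t.1.1.2), t.1.2)) (fun _ _ h => by simp_all [Prod.ext_iff])
  have rS₂ := ent_comp_of_injective (μ := μ) ((hUbar.prodMk (hS₁.prodMk hS₂)).prodMk hY)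
    (f := fun t => (t, t.1.2.2)) (fun _ _ h => by simp_all [Prod.ext_iff])
  have rsub := ent_comp_of_injective (μ := μ) (hUbar.prodMk (hS₂.prodMk hY))
    (f := fun t => ((t.1, t.2.2), t.2.1)) (fun _ _ h => by simp_all [Prod.ext_iff])
  have hmono := ent_comp_le (μ := μ) ((hUbar.prodMk (hS₁.prodMk hS₂)).prodMk hY)
    fun t => ((t.1.1, t.2), t.1.2.2)
  have hsub := ent_submodular (μ := μ) hUbar hS₂ hY
  rw [hBer] at hUY hUSY
  simp only at rUY rUSY rS₂ rsub hmono
  simp only [condMI, condEnt]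
  rw [rUY, rUSY, hUY, hUSY, rS₂]
  rw [← rsub] at hsub
  constructor
  · linarith [mul_le_mul_of_nonneg_left hsub hα0]
  · linarith [mul_le_mul_of_nonneg_left hmono hα0]
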